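/- arXiv:1211.1696 — 2 statements merged into one kernel-verified Lean document; each statement's English description precedes it below -/
import Mathlib

section
/- Let v̄ > 0 and let (t_i)_{i≥0} be a non-increasing sequence of real numbers. Let V : [0,∞) → ℝ be a continuous function with V(x) = −t_i x + e_i for x ∈ [i v̄, (i+1) v̄), i ∈ ℤ≥0 (for some real intercepts e_i). Fix i ∈ ℤ≥0, s ∈ [i v̄, (i+1) v̄), and λ ∈ ℝ. Then the minimum of v ↦ λ v + V(s+v) over v ∈ [max(−s, −v̄), v̄] is attained at v* = max(−s, −v̄) if λ > t_{max(0,i−1)}; at v* = i v̄ − s if i ≥ 1 and t_i < λ ≤ t_{i−1}; at v* = (i+1) v̄ − s if t_{i+1} < λ ≤ t_i; and at v* = v̄ if λ ≤ t_{i+1}. -/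
open Filter Topology in
/-- Consecutive affine pieces of a continuous piecewise affine function agree at the breakpoint. -/
lemma affine_pieces_agree_at_breakpoint {w : ℝ} (hw : 0 < w) {t e : ℕ → ℝ} {V : ℝ → ℝ}
    (hVcont : ContinuousOn V (Set.Ici 0))
    (hV : ∀ i : ℕ, ∀ x ∈ Set.Ico ((i : ℝ) * w) (((i : ℝ) + 1) * w), V x = -(t i) * x + e i)
    (j : ℕ) :
    -(t (j + 1)) * (((j : ℝ) + 1) * w) + e (j + 1) = -(t j) * (((j : ℝ) + 1) * w) + e j := by
  have hb : 0 < ((j : ℝ) + 1) * w := by positivity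
  have hlt : (j : ℝ) * w < ((j : ℝ) + 1) * w := by linarith
  have hright : V (((j : ℝ) + 1) * w) = -(t (j + 1)) * (((j : ℝ) + 1) * w) + e (j + 1) := by
    apply hV (j + 1)
    push_cast
    constructor <;> linarith
  have hlim : Tendsto V (𝓝[<] (((j : ℝ) + 1) * w)) (𝓝 (V (((j : ℝ) + 1) * w))) :=
    (hVcont.continuousAt (Ici_mem_nhds hb)).tendsto.mono_left nhdsWithin_le_nhds
  have haff : Tendsto (fun x => -(t j) * x + e j) (𝓝[<] (((j : ℝ) + 1) * w))
      (𝓝 (-(t j) * (((j : ℝ) + 1) * w) + e j)) :=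
    (Continuous.tendsto (by fun_prop) _).mono_left nhdsWithin_le_nhds
  have heq : V =ᶠ[𝓝[<] (((j : ℝ) + 1) * w)] fun x => -(t j) * x + e j := by
    filter_upwards [Ioo_mem_nhdsLT hlt] with x hx
    exact hV j x ⟨hx.1.le, hx.2⟩
  rw [← hright]
  exact tendsto_nhds_unique hlim (haff.congr' heq.symm)

/-- Every affine piece of a continuous piecewise affine function with non-decreasing slopes
supports the function from below. -/
lemma affine_piece_le {w : ℝ} (hw : 0 < w) {t e : ℕ → ℝ} (ht : Antitone t) {V : ℝ → ℝ}
    (hVcont : ContinuousOn V (Set.Ici 0))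
    (hV : ∀ i : ℕ, ∀ x ∈ Set.Ico ((i : ℝ) * w) (((i : ℝ) + 1) * w), V x = -(t i) * x + e i)
    (j : ℕ) {x : ℝ} (hx : 0 ≤ x) :
    -(t j) * x + e j ≤ V x := by
  have hagree := affine_pieces_agree_at_breakpoint hw hVcont hV
  have hstep (n : ℕ) : 0 ≤ t n - t (n + 1) := sub_nonneg.2 (ht n.le_succ)
  obtain ⟨k, hk⟩ : ∃ k : ℕ, x ∈ Set.Ico ((k : ℝ) * w) (((k : ℝ) + 1) * w) :=
    ⟨⌊x / w⌋₊, (le_div_iff₀ hw).1 (Nat.floor_le (by positivity)),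
      (div_lt_iff₀ hw).1 (Nat.lt_floor_add_one _)⟩
  rw [hV k x hk]
  rcases le_total j k with h | h
  · have key : ∀ n, j ≤ n → (n : ℝ) * w ≤ x → -(t j) * x + e j ≤ -(t n) * x + e n := by
      intro n hn
      induction n, hn using Nat.le_induction with
      | base => exact fun _ => le_rfl
      | succ n _ ih =>
        intro hnx
        push_cast at hnx
        have := ih (by linarith)
        linarith [mul_nonneg (hstep n) (sub_nonneg.2 hnx), hagree n]
    exact key k h hk.1
  · induction j, h using Nat.le_induction with
    | base => exact le_rfl
    | succ n hn ih =>
      have hkn : (k : ℝ) ≤ n := by exact_mod_cast hn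
      have hxn : x ≤ ((n : ℝ) + 1) * w := hk.2.le.trans (by gcongr)
      linarith [mul_nonneg (hstep n) (sub_nonneg.2 hxn), hagree n]

/-- Single-stage minimizer characterization underlying the optimal threshold
policy (Theorem 1(i)): `V` is continuous on `[0,∞)`, piecewise affine with
slope `-tᵢ` on `[i v̄, (i+1) v̄)` for a non-increasing sequence of thresholds
`tᵢ`.  For `s ∈ [i v̄, (i+1) v̄)` the minimum of `v ↦ λ v + V(s+v)` over
`[max(−s,−v̄), v̄]` is attained at the stated threshold actions. -/
theorem stmt_0
    (vbar : ℝ) (hvbar : 0 < vbar)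
    (t : ℕ → ℝ) (ht : Antitone t)
    (e : ℕ → ℝ) (V : ℝ → ℝ)
    (hVcont : ContinuousOn V (Set.Ici 0))
    (hV : ∀ i : ℕ, ∀ x ∈ Set.Ico ((i : ℝ) * vbar) (((i : ℝ) + 1) * vbar),
      V x = -(t i) * x + e i)
    (i : ℕ) (s : ℝ) (hs : s ∈ Set.Ico ((i : ℝ) * vbar) (((i : ℝ) + 1) * vbar))
    (lam : ℝ) :
    (t (max 0 (i - 1)) < lam →
      max (-s) (-vbar) ∈ Set.Icc (max (-s) (-vbar)) vbar ∧
      ∀ v ∈ Set.Icc (max (-s) (-vbar)) vbar,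
        lam * max (-s) (-vbar) + V (s + max (-s) (-vbar)) ≤ lam * v + V (s + v)) ∧
    (1 ≤ i → t i < lam → lam ≤ t (i - 1) →
      (i : ℝ) * vbar - s ∈ Set.Icc (max (-s) (-vbar)) vbar ∧
      ∀ v ∈ Set.Icc (max (-s) (-vbar)) vbar,
        lam * ((i : ℝ) * vbar - s) + V (s + ((i : ℝ) * vbar - s)) ≤ lam * v + V (s + v)) ∧
    (t (i + 1) < lam → lam ≤ t i →
      ((i : ℝ) + 1) * vbar - s ∈ Set.Icc (max (-s) (-vbar)) vbar ∧
      ∀ v ∈ Set.Icc (max (-s) (-vbar)) vbar,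
        lam * (((i : ℝ) + 1) * vbar - s) + V (s + (((i : ℝ) + 1) * vbar - s))
          ≤ lam * v + V (s + v)) ∧
    (lam ≤ t (i + 1) →
      vbar ∈ Set.Icc (max (-s) (-vbar)) vbar ∧
      ∀ v ∈ Set.Icc (max (-s) (-vbar)) vbar,
        lam * vbar + V (s + vbar) ≤ lam * v + V (s + v)) := by
  have hsupp (j : ℕ) {x : ℝ} (hx : 0 ≤ x) : -(t j) * x + e j ≤ V x :=
    affine_piece_le hvbar ht hVcont hV j hx
  have hleft (j : ℕ) : V ((j : ℝ) * vbar) = -(t j) * ((j : ℝ) * vbar) + e j :=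
    hV j _ ⟨le_rfl, by linarith⟩
  have hright (j : ℕ) : V (((j : ℝ) + 1) * vbar) = -(t j) * (((j : ℝ) + 1) * vbar) + e j := by
    have h := hleft (j + 1)
    push_cast at h
    rw [h, affine_pieces_agree_at_breakpoint hvbar hVcont hV j]
  have hmin_right {j : ℕ} {y x : ℝ} (hj : t j ≤ lam) (hy : V y = -(t j) * y + e j)
      (hx : 0 ≤ x) (hyx : y ≤ x) : lam * y + V y ≤ lam * x + V x := by
    linarith [hsupp j hx, mul_nonneg (sub_nonneg.2 hj) (sub_nonneg.2 hyx)]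
  have hmin_left {j : ℕ} {y x : ℝ} (hj : lam ≤ t j) (hy : V y = -(t j) * y + e j)
      (hx : 0 ≤ x) (hxy : x ≤ y) : lam * y + V y ≤ lam * x + V x := by
    linarith [hsupp j hx, mul_nonneg (sub_nonneg.2 hj) (sub_nonneg.2 hxy)]
  obtain ⟨hs1, hs2⟩ := hs
  have hi0 : 0 ≤ (i : ℝ) * vbar := by positivity
  have hs0 : 0 ≤ s := hi0.trans hs1
  have hnonneg {v : ℝ} (hv : v ∈ Set.Icc (max (-s) (-vbar)) vbar) : 0 ≤ s + v := by
    linarith [(le_max_left (-s) (-vbar)).trans hv.1]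
  refine ⟨fun h => ?_, fun h1 h2 h3 => ?_, fun h1 h2 => ?_, fun h => ?_⟩
  · refine ⟨⟨le_rfl, max_le (by linarith) (by linarith)⟩, fun v hv => ?_⟩
    have hpiece : V (s + max (-s) (-vbar))
        = -(t (max 0 (i - 1))) * (s + max (-s) (-vbar)) + e (max 0 (i - 1)) := by
      apply hV
      rcases i with _ | n
      · have hsv : s < vbar := by simpa using hs2
        rw [max_eq_left (by linarith : -vbar ≤ -s)]
        simpa using hvbar
      · push_cast at hs1 hs2
        have hn0 : 0 ≤ (n : ℝ) * vbar := by positivity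
        rw [max_eq_right (by linarith : -s ≤ -vbar)]
        simp only [Nat.add_sub_cancel, Nat.zero_max, Set.mem_Ico]
        constructor <;> linarith
    linarith [hmin_right h.le hpiece (hnonneg hv) (by linarith [hv.1])]
  · obtain ⟨n, rfl⟩ := Nat.exists_eq_add_of_le' h1
    refine ⟨⟨max_le (by linarith) (by linarith), by linarith⟩, fun v hv => ?_⟩
    rw [add_sub_cancel]
    rcases le_total (((n + 1 : ℕ) : ℝ) * vbar) (s + v) with hx | hx
    · linarith [hmin_right h2.le (hleft (n + 1)) (hnonneg hv) hx]
    · have hn : V (((n + 1 : ℕ) : ℝ) * vbar) = -(t n) * (((n + 1 : ℕ) : ℝ) * vbar) + e n := by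
        exact_mod_cast hright n
      linarith [hmin_left h3 hn (hnonneg hv) hx]
  · refine ⟨⟨max_le (by linarith) (by linarith), by linarith⟩, fun v hv => ?_⟩
    rw [add_sub_cancel]
    rcases le_total (((i : ℝ) + 1) * vbar) (s + v) with hx | hx
    · have hi : V (((i : ℝ) + 1) * vbar) = -(t (i + 1)) * (((i : ℝ) + 1) * vbar) + e (i + 1) := by
        exact_mod_cast hleft (i + 1)
      linarith [hmin_right h1.le hi (hnonneg hv) hx]
    · linarith [hmin_left h2 (hright i) (hnonneg hv) hx]
  · refine ⟨⟨max_le (by linarith) (by linarith), le_rfl⟩, fun v hv => ?_⟩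
    have hpiece : V (s + vbar) = -(t (i + 1)) * (s + vbar) + e (i + 1) := by
      apply hV
      push_cast
      constructor <;> linarith
    linarith [hmin_left h hpiece (hnonneg hv) (by linarith [hv.2])]
end

section
/- Fix real numbers 0 ≤ λ_min ≤ λ_max, a ramp rate v̄ > 0, an integer n ≥ 1, and capacity s̄ = n v̄. Define H* : [0, s̄] → ℝ by H*(s) = −((i+1)λ_min + (n−i)λ_max)/(n+1) · s − i(i+1)(λ_max − λ_min) v̄ / (2(n+1)) for s ∈ [i v̄, (i+1) v̄) with i ∈ {0,…,n−1}, and with i = n−1 used for s = s̄. Then for every s ∈ [0, s̄], H*(s) = (1/2) · min_{v ∈ [max(−s,−v̄), min(v̄, s̄−s)]} ( λ_min v + H*(s+v) ) + (1/2) · min_{v ∈ [max(−s,−v̄), min(v̄, s̄−s)]} ( λ_max v + H*(s+v) ) + v̄ (λ_max − λ_min) n / (2(n+1)). -/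
/-- The `i`-th affine piece of the differential cost function, where `d = (λ_max - λ_min) / (n + 1)`
is the common difference of consecutive slopes. -/
noncomputable def costPiece (l d w : ℝ) (n i : ℕ) (s : ℝ) : ℝ :=
  -(l + ((n : ℝ) - i) * d) * s - (i : ℝ) * (i + 1) / 2 * d * w

lemma costPiece_le_costPiece {l d w : ℝ} (hd : 0 ≤ d) (hw : 0 ≤ w) (n : ℕ) {i : ℕ} (j : ℕ) {s : ℝ}
    (h₁ : (i : ℝ) * w ≤ s) (h₂ : s ≤ ((i : ℝ) + 1) * w) :
    costPiece l d w n j s ≤ costPiece l d w n i s := by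
  have key : costPiece l d w n i s - costPiece l d w n j s
      = d * (((i : ℝ) - j) * (s - w * ((i : ℝ) + j + 1) / 2)) := by
    unfold costPiece; ring
  have hnonneg : 0 ≤ ((i : ℝ) - j) * (s - w * ((i : ℝ) + j + 1) / 2) := by
    rcases lt_trichotomy i j with h | rfl | h
    · have h' : (i : ℝ) + 1 ≤ j := by exact_mod_cast h
      exact mul_nonneg_of_nonpos_of_nonpos (by linarith) (by nlinarith)
    · simp
    · have h' : (j : ℝ) + 1 ≤ i := by exact_mod_cast h
      exact mul_nonneg (by linarith) (by nlinarith)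
  linarith [mul_nonneg hd hnonneg]

lemma exists_nat_mul_le_le_succ_mul {w s : ℝ} (hw : 0 < w) {n : ℕ} (hn : 1 ≤ n)
    (hs : s ∈ Set.Icc 0 ((n : ℝ) * w)) :
    ∃ i < n, (i : ℝ) * w ≤ s ∧ s ≤ ((i : ℝ) + 1) * w := by
  rcases hs.2.lt_or_eq with h | rfl
  · have h0 : 0 ≤ s / w := div_nonneg hs.1 hw.le
    refine ⟨⌊s / w⌋₊, (Nat.floor_lt h0).2 ((div_lt_iff₀ hw).2 h), ?_, ?_⟩
    · exact (le_div_iff₀ hw).1 (Nat.floor_le h0)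
    · exact ((div_lt_iff₀ hw).1 (Nat.lt_floor_add_one _)).le
  · obtain ⟨m, rfl⟩ := Nat.exists_eq_add_of_le' hn
    refine ⟨m, m.lt_succ_self, ?_, ?_⟩ <;> push_cast <;> linarith

lemma antitoneOn_add_of_eq_costPiece {l d w : ℝ} (hd : 0 ≤ d) (hw : 0 < w) {n : ℕ} (hn : 1 ≤ n)
    {H : ℝ → ℝ} (hH : ∀ i < n, ∀ s, (i : ℝ) * w ≤ s → s ≤ ((i : ℝ) + 1) * w →
      H s = costPiece l d w n i s) :
    AntitoneOn (fun s => l * s + H s) (Set.Icc 0 ((n : ℝ) * w)) := by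
  intro x hx y hy hxy
  obtain ⟨i, hi, hi₁, hi₂⟩ := exists_nat_mul_le_le_succ_mul hw hn hx
  obtain ⟨j, hj, hj₁, hj₂⟩ := exists_nat_mul_le_le_succ_mul hw hn hy
  have h := costPiece_le_costPiece (l := l) hd hw.le n j hi₁ hi₂
  have hj' : (j : ℝ) ≤ n := by exact_mod_cast hj.le
  have hslope := mul_nonneg (mul_nonneg (sub_nonneg.2 hj') hd) (sub_nonneg.2 hxy)
  simp only [hH i hi x hi₁ hi₂, hH j hj y hj₁ hj₂]
  refine le_trans ?_ (add_le_add_right h (l * x))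
  unfold costPiece
  linarith

lemma monotoneOn_add_of_eq_costPiece {l d w : ℝ} (hd : 0 ≤ d) (hw : 0 < w) {n : ℕ} (hn : 1 ≤ n)
    {H : ℝ → ℝ} (hH : ∀ i < n, ∀ s, (i : ℝ) * w ≤ s → s ≤ ((i : ℝ) + 1) * w →
      H s = costPiece l d w n i s) :
    MonotoneOn (fun s => (l + ((n : ℝ) + 1) * d) * s + H s) (Set.Icc 0 ((n : ℝ) * w)) := by
  intro x hx y hy hxy
  obtain ⟨i, hi, hi₁, hi₂⟩ := exists_nat_mul_le_le_succ_mul hw hn hx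
  obtain ⟨j, hj, hj₁, hj₂⟩ := exists_nat_mul_le_le_succ_mul hw hn hy
  have h := costPiece_le_costPiece (l := l) hd hw.le n i hj₁ hj₂
  have hslope := mul_nonneg (mul_nonneg (by positivity : (0 : ℝ) ≤ (i : ℝ) + 1) hd)
    (sub_nonneg.2 hxy)
  simp only [hH i hi x hi₁ hi₂, hH j hj y hj₁ hj₂]
  refine le_trans ?_ (add_le_add_right h ((l + ((n : ℝ) + 1) * d) * y))
  unfold costPiece
  linarith

/-- Verification in Theorem 2 that the piecewise linear differential cost
function `H*` solves the average-cost Bellman equation for the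
infinite-horizon ramp-constrained storage problem under the symmetric
two-point price distribution on `{λ_min, λ_max}`, with optimal average value
`v̄(λ_max − λ_min)/2 · n/(n+1)`. -/
theorem stmt_9
    (lmin lmax vbar : ℝ) (hlmin : 0 ≤ lmin) (hl : lmin ≤ lmax) (hvbar : 0 < vbar)
    (n : ℕ) (hn : 1 ≤ n)
    (H : ℝ → ℝ)
    (hH : ∀ i : ℕ, i < n →
      ∀ s ∈ Set.Ico ((i : ℝ) * vbar) (((i : ℝ) + 1) * vbar),
        H s = -((((i : ℝ) + 1) * lmin + ((n : ℝ) - (i : ℝ)) * lmax) / ((n : ℝ) + 1)) * s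
          - (i : ℝ) * ((i : ℝ) + 1) * (lmax - lmin) * vbar / (2 * ((n : ℝ) + 1)))
    (hHtop : H ((n : ℝ) * vbar)
      = -(((n : ℝ) * lmin + lmax) / ((n : ℝ) + 1)) * ((n : ℝ) * vbar)
        - ((n : ℝ) - 1) * (n : ℝ) * (lmax - lmin) * vbar / (2 * ((n : ℝ) + 1))) :
    ∀ s ∈ Set.Icc (0 : ℝ) ((n : ℝ) * vbar),
      H s = (1 / 2) * sInf ((fun v => lmin * v + H (s + v)) ''
              Set.Icc (max (-s) (-vbar)) (min vbar ((n : ℝ) * vbar - s)))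
          + (1 / 2) * sInf ((fun v => lmax * v + H (s + v)) ''
              Set.Icc (max (-s) (-vbar)) (min vbar ((n : ℝ) * vbar - s)))
          + vbar * (lmax - lmin) * (n : ℝ) / (2 * ((n : ℝ) + 1)) := by
  obtain ⟨d, hd, rfl⟩ : ∃ d, 0 ≤ d ∧ lmax = lmin + ((n : ℝ) + 1) * d :=
    ⟨(lmax - lmin) / (n + 1), div_nonneg (sub_nonneg.2 hl) (by positivity), by field_simp; ring⟩
  have hpiece : ∀ i < n, ∀ s, (i : ℝ) * vbar ≤ s → s ≤ ((i : ℝ) + 1) * vbar →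
      H s = costPiece lmin d vbar n i s := by
    intro i hi s h₁ h₂
    rcases h₂.lt_or_eq with h₂ | rfl
    · rw [hH i hi s ⟨h₁, h₂⟩, costPiece]
      field_simp
      ring
    · rcases (Nat.succ_le_of_lt hi).lt_or_eq with h | rfl
      · have := hH (i + 1) h (((i : ℝ) + 1) * vbar)
          ⟨by push_cast; exact le_rfl, by push_cast; nlinarith⟩
        rw [this, costPiece]
        push_cast
        field_simp
        ring
      · push_cast at hHtop
        rw [hHtop, costPiece]
        push_cast
        field_simp
        ring
  have hanti := antitoneOn_add_of_eq_costPiece hd hvbar hn hpiece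
  have hmono := monotoneOn_add_of_eq_costPiece hd hvbar hn hpiece
  intro s hs
  have hmem : ∀ v ∈ Set.Icc (max (-s) (-vbar)) (min vbar ((n : ℝ) * vbar - s)),
      s + v ∈ Set.Icc 0 ((n : ℝ) * vbar) := fun v hv =>
    ⟨by linarith [(le_max_left _ _).trans hv.1], by linarith [hv.2.trans (min_le_right _ _)]⟩
  have hne : max (-s) (-vbar) ≤ min vbar ((n : ℝ) * vbar - s) :=
    (max_le (by linarith [hs.1]) (by linarith)).trans
      (le_min hvbar.le (by linarith [hs.2]) : (0 : ℝ) ≤ _)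
  have hbuy : IsLeast ((fun v => lmin * v + H (s + v)) ''
      Set.Icc (max (-s) (-vbar)) (min vbar ((n : ℝ) * vbar - s)))
      (lmin * min vbar ((n : ℝ) * vbar - s) + H (s + min vbar ((n : ℝ) * vbar - s))) := by
    refine ⟨⟨_, Set.right_mem_Icc.2 hne, rfl⟩, ?_⟩
    rintro _ ⟨v, hv, rfl⟩
    have := hanti (hmem v hv) (hmem _ (Set.right_mem_Icc.2 hne)) (add_le_add_right hv.2 s)
    simp only at this ⊢
    linarith
  have hsell : IsLeast ((fun v => (lmin + ((n : ℝ) + 1) * d) * v + H (s + v)) ''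
      Set.Icc (max (-s) (-vbar)) (min vbar ((n : ℝ) * vbar - s)))
      ((lmin + ((n : ℝ) + 1) * d) * max (-s) (-vbar) + H (s + max (-s) (-vbar))) := by
    refine ⟨⟨_, Set.left_mem_Icc.2 hne, rfl⟩, ?_⟩
    rintro _ ⟨v, hv, rfl⟩
    have := hmono (hmem _ (Set.left_mem_Icc.2 hne)) (hmem v hv) (add_le_add_right hv.1 s)
    simp only at this ⊢
    linarith
  rw [hbuy.csInf_eq, hsell.csInf_eq]
  obtain ⟨i, hi, h₁, h₂⟩ := exists_nat_mul_le_le_succ_mul hvbar hn hs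
  have hup : lmin * min vbar ((n : ℝ) * vbar - s) + H (s + min vbar ((n : ℝ) * vbar - s))
      = costPiece lmin d vbar n (i + 1) (s + vbar) + lmin * vbar := by
    rcases (Nat.succ_le_of_lt hi).lt_or_eq with h | rfl
    · have h' : (i : ℝ) + 1 + 1 ≤ n := by exact_mod_cast h
      have hle : vbar ≤ (n : ℝ) * vbar - s := by nlinarith
      rw [min_eq_left hle, hpiece (i + 1) h (s + vbar) (by push_cast; linarith)
        (by push_cast; linarith)]
      ring
    · rw [min_eq_right (by push_cast; linarith), add_sub_cancel,
        hpiece i hi _ (by push_cast; linarith) (by push_cast; linarith)]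
      unfold costPiece
      push_cast
      ring
  have hdown : (lmin + ((n : ℝ) + 1) * d) * max (-s) (-vbar) + H (s + max (-s) (-vbar))
      = -(lmin + ((n : ℝ) - i + 1) * d) * (s - vbar) - ((i : ℝ) - 1) * i / 2 * d * vbar
        - (lmin + ((n : ℝ) + 1) * d) * vbar := by
    cases i with
    | zero =>
      push_cast at h₁ h₂
      rw [max_eq_left (by linarith), hpiece 0 hi _ (by simp) (by simp [hvbar.le])]
      unfold costPiece
      push_cast
      ring
    | succ k =>
      push_cast at h₁ h₂
      have hk : 0 ≤ (k : ℝ) * vbar := by positivity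
      rw [max_eq_right (by linarith), hpiece k (by omega) _ (by linarith) (by linarith)]
      unfold costPiece
      push_cast
      ring
  rw [hup, hdown, hpiece i hi s h₁ h₂]
  unfold costPiece
  push_cast
  field_simp
  ring
end
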